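/- arXiv:math/0411257 — 3 statements merged into one kernel-verified Lean document; each statement's English description precedes it below -/
import Mathlib

section
/- Let μ ∈ W be determined by coefficient pairs A,B,C,D,E,F ∈ ℝ² with E = B and D = −C (so that J is an abelian complex structure on (ℝ⁶, μ)). Then the restriction of the Ricci operator to n₁ commutes with J, i.e. Ricc_μ|_{n₁} = Ric_μ|_{n₁}, and Ricc_μ|_{n₁} is a scalar multiple of the identity if and only if ⟨A+F, B⟩ = 0, ⟨A+F, C⟩ = 0 and ‖A‖² = ‖F‖². -/
open scoped BigOperators Matrix

abbrev Vm (m : ℕ) := (Fin m → ℝ) → (Fin m → ℝ) → (Fin m → ℝ)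

/-- standard basis vector `e_i` of `ℝᵐ`. -/
noncomputable def stdb (m : ℕ) (i : Fin m) : Fin m → ℝ := Pi.single i 1

/-- The Ricci operator (as a matrix in the standard orthonormal basis):
`⟨Ric_μ e_x, e_y⟩ = -(1/2) Σ_{i,j} ⟨μ(e_x,e_i),e_j⟩⟨μ(e_y,e_i),e_j⟩
                  + (1/4) Σ_{i,j} ⟨μ(e_i,e_j),e_x⟩⟨μ(e_i,e_j),e_y⟩`. -/
noncomputable def Ric {m : ℕ} (μ : Vm m) : Matrix (Fin m) (Fin m) ℝ :=
  Matrix.of fun x y =>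
    -(1/2) * (∑ i, ∑ j, μ (stdb m x) (stdb m i) j * μ (stdb m y) (stdb m i) j)
      + (1/4) * (∑ i, ∑ j, μ (stdb m i) (stdb m j) x * μ (stdb m i) (stdb m j) y)

/-- `D` is a derivation of the bracket `μ`. -/
def IsDeriv {m : ℕ} (μ : Vm m) (D : Matrix (Fin m) (Fin m) ℝ) : Prop :=
  ∀ X Y, D.mulVec (μ X Y) = μ (D.mulVec X) Y + μ X (D.mulVec Y)

/-- The complex structure `J` on `ℝ⁶ = n₁ ⊕ n₂` (basis `X_1,…,X_4,Z_1,Z_2`):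
`JX_1 = X_2, JX_2 = -X_1, JX_3 = X_4, JX_4 = -X_3, JZ_1 = Z_2, JZ_2 = -Z_1`. -/
noncomputable def Jc : Matrix (Fin 6) (Fin 6) ℝ :=
  !![0, -1, 0, 0, 0, 0;
     1, 0, 0, 0, 0, 0;
     0, 0, 0, -1, 0, 0;
     0, 0, 1, 0, 0, 0;
     0, 0, 0, 0, 0, -1;
     0, 0, 0, 0, 1, 0]

/-- `J` acting on coefficient pairs: `J(p,q) = (-q,p)`. -/
def Jpair (p : ℝ × ℝ) : ℝ × ℝ := (-p.2, p.1)

/-- The vector `p₁ Z_1 + p₂ Z_2 ∈ n₂ ⊆ ℝ⁶`. -/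
noncomputable def zvec (p : ℝ × ℝ) : Fin 6 → ℝ := p.1 • stdb 6 4 + p.2 • stdb 6 5

/-- The element of `W = Λ²n₁* ⊗ n₂` (extended to a 2-step nilpotent bracket on
`ℝ⁶ = n₁ ⊕ n₂` with `n₂` central) with coefficient pairs `A,B,C,D,E,F`:
`μ(X_1,X_2) = a₁Z_1 + a₂Z_2`, `μ(X_1,X_3) = b₁Z_1 + b₂Z_2`, `μ(X_1,X_4) = c₁Z_1 + c₂Z_2`,
`μ(X_2,X_3) = d₁Z_1 + d₂Z_2`, `μ(X_2,X_4) = e₁Z_1 + e₂Z_2`, `μ(X_3,X_4) = f₁Z_1 + f₂Z_2`. -/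
noncomputable def muW (A B C D E F : ℝ × ℝ) : Vm 6 :=
  fun X Y =>
    (X 0 * Y 1 - X 1 * Y 0) • zvec A +
    (X 0 * Y 2 - X 2 * Y 0) • zvec B +
    (X 0 * Y 3 - X 3 * Y 0) • zvec C +
    (X 1 * Y 2 - X 2 * Y 1) • zvec D +
    (X 1 * Y 3 - X 3 * Y 1) • zvec E +
    (X 2 * Y 3 - X 3 * Y 2) • zvec F

/-- The complexified Ricci operator `Ricc_μ = (1/2)(Ric_μ - J Ric_μ J)` on `ℝ⁶`. -/
noncomputable def Ricc6 (μ : Vm 6) : Matrix (Fin 6) (Fin 6) ℝ :=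
  (1/2 : ℝ) • (Ric μ - Jc * Ric μ * Jc)

theorem muW_eq_vec (A B C D E F : ℝ × ℝ) (X Y : Fin 6 → ℝ) :
    muW A B C D E F X Y =
      ![0, 0, 0, 0,
        (X 0 * Y 1 - X 1 * Y 0) * A.1 + (X 0 * Y 2 - X 2 * Y 0) * B.1 +
          (X 0 * Y 3 - X 3 * Y 0) * C.1 + (X 1 * Y 2 - X 2 * Y 1) * D.1 +
          (X 1 * Y 3 - X 3 * Y 1) * E.1 + (X 2 * Y 3 - X 3 * Y 2) * F.1,
        (X 0 * Y 1 - X 1 * Y 0) * A.2 + (X 0 * Y 2 - X 2 * Y 0) * B.2 +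
          (X 0 * Y 3 - X 3 * Y 0) * C.2 + (X 1 * Y 2 - X 2 * Y 1) * D.2 +
          (X 1 * Y 3 - X 3 * Y 1) * E.2 + (X 2 * Y 3 - X 3 * Y 2) * F.2] := by
  ext k
  fin_cases k <;> simp [muW, zvec, stdb]

set_option maxHeartbeats 2000000 in
/-- The Ricci operator of `μ ∈ W` with `E = B` and `D = -C` as an explicit matrix. -/
theorem Ric_muW_abelian (A B C F : ℝ × ℝ) :
    Ric (muW A B C (-C) B F) =
      let s := -(1/2) * (A.1 ^ 2 + A.2 ^ 2 + B.1 ^ 2 + B.2 ^ 2 + C.1 ^ 2 + C.2 ^ 2)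
      let t := -(1/2) * (F.1 ^ 2 + F.2 ^ 2 + B.1 ^ 2 + B.2 ^ 2 + C.1 ^ 2 + C.2 ^ 2)
      let b := (1/2) * ((A.1 + F.1) * B.1 + (A.2 + F.2) * B.2)
      let c := -(1/2) * ((A.1 + F.1) * C.1 + (A.2 + F.2) * C.2)
      let u := (1/2) * (A.1 ^ 2 + 2 * B.1 ^ 2 + 2 * C.1 ^ 2 + F.1 ^ 2)
      let v := (1/2) * (A.1 * A.2 + 2 * B.1 * B.2 + 2 * C.1 * C.2 + F.1 * F.2)
      let w := (1/2) * (A.2 ^ 2 + 2 * B.2 ^ 2 + 2 * C.2 ^ 2 + F.2 ^ 2)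
      !![s, 0, c, b, 0, 0;
         0, s, -b, c, 0, 0;
         c, -b, t, 0, 0, 0;
         b, c, 0, t, 0, 0;
         0, 0, 0, 0, u, v;
         0, 0, 0, 0, v, w] := by
  ext i j
  simp only [Ric, Matrix.of_apply, muW_eq_vec, stdb, Fin.sum_univ_six]
  simp only [Fin.isValue, Matrix.cons_val, mul_zero, zero_add, Pi.single_apply, Fin.reduceEq,
    if_true, if_false, sub_zero, zero_sub, zero_mul, mul_one, one_mul, add_zero, neg_mul]
  fin_cases i <;> fin_cases j <;> simp <;> ring

/-- for `μ ∈ W` with `E = B`, `D = -C` (so that `J` is abelian on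
`(ℝ⁶,μ)`), the restriction of the Ricci operator to `n₁` commutes with `J`, i.e.
`Ricc_μ|_{n₁} = Ric_μ|_{n₁}`, and `Ricc_μ|_{n₁}` is a scalar multiple of the identity
iff `⟨A+F,B⟩ = 0`, `⟨A+F,C⟩ = 0` and `‖A‖² = ‖F‖²`. -/
theorem muW_abelian_Ricc (A B C D E F : ℝ × ℝ) (hE : E = B) (hD : D = -C) :
    (∀ i j : Fin 6, (i : ℕ) < 4 → (j : ℕ) < 4 →
        Ricc6 (muW A B C D E F) i j = Ric (muW A B C D E F) i j) ∧
    ((∃ p : ℝ, ∀ i j : Fin 6, (i : ℕ) < 4 → (j : ℕ) < 4 →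
          Ricc6 (muW A B C D E F) i j = if i = j then p else 0) ↔
      ((A.1 + F.1) * B.1 + (A.2 + F.2) * B.2 = 0 ∧
       (A.1 + F.1) * C.1 + (A.2 + F.2) * C.2 = 0 ∧
       A.1^2 + A.2^2 = F.1^2 + F.2^2)) := by
  subst hE hD
  have hRicc : ∀ i j : Fin 6, (i : ℕ) < 4 → (j : ℕ) < 4 →
      Ricc6 (muW A E C (-C) E F) i j = Ric (muW A E C (-C) E F) i j := by
    intro i j hi hj
    rw [Ricc6, Ric_muW_abelian]
    fin_cases i <;> fin_cases j <;> first
      | (simp at hi hj; done)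
      | (simp [Jc] <;> ring)
  refine ⟨hRicc, ?_, ?_⟩
  · rintro ⟨p, hp⟩
    have entry : ∀ i j : Fin 6, (i : ℕ) < 4 → (j : ℕ) < 4 →
        Ric (muW A E C (-C) E F) i j = if i = j then p else 0 :=
      fun i j hi hj => (hRicc i j hi hj).symm.trans (hp i j hi hj)
    rw [Ric_muW_abelian] at entry
    have h00 := entry 0 0 (by decide) (by decide)
    have h22 := entry 2 2 (by decide) (by decide)
    have h02 := entry 0 2 (by decide) (by decide)
    have h03 := entry 0 3 (by decide) (by decide)
    simp [-mul_eq_zero] at h00 h22 h02 h03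
    refine ⟨?_, ?_, ?_⟩ <;> linarith
  · rintro ⟨hB, hC, hAF⟩
    refine ⟨-(1/2) * (A.1 ^ 2 + A.2 ^ 2 + E.1 ^ 2 + E.2 ^ 2 + C.1 ^ 2 + C.2 ^ 2),
      fun i j hi hj => ?_⟩
    rw [hRicc i j hi hj, Ric_muW_abelian]
    fin_cases i <;> fin_cases j <;> first
      | (simp at hi hj; done)
      | simp [hB, hC, hAF]
end

section
/- For every μ ∈ W₈ (every skew-symmetric bilinear map μ : n₁ × n₁ → n₂ extended to a 2-step nilpotent bracket on ℝ⁸ = n₁ ⊕ n₂ with n₂ central), the invariant Ricci operator Ricg_μ = (1/4)(Ric_μ − J₁Ric_μJ₁ − J₂Ric_μJ₂ − J₃Ric_μJ₃) satisfies Ricg_μ = cI + D for some c ∈ ℝ and some derivation D ∈ Der(μ); indeed Ricg_μ equals pI on n₁ and qI on n₂ for some p, q ∈ ℝ, and the map equal to (q−p)I on n₁ and 2(q−p)I on n₂ is a derivation of μ. -/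
open scoped BigOperators Matrix

/-- `J₁` on `ℝ⁸ = n₁ ⊕ n₂`, acting on each factor by
`[[0,-1,0,0],[1,0,0,0],[0,0,0,-1],[0,0,1,0]]`. -/
noncomputable def J1m : Matrix (Fin 8) (Fin 8) ℝ :=
  !![0,-1, 0, 0, 0, 0, 0, 0;
     1, 0, 0, 0, 0, 0, 0, 0;
     0, 0, 0,-1, 0, 0, 0, 0;
     0, 0, 1, 0, 0, 0, 0, 0;
     0, 0, 0, 0, 0,-1, 0, 0;
     0, 0, 0, 0, 1, 0, 0, 0;
     0, 0, 0, 0, 0, 0, 0,-1;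
     0, 0, 0, 0, 0, 0, 1, 0]

/-- `J₂` on `ℝ⁸ = n₁ ⊕ n₂`, acting on each factor by
`[[0,0,-1,0],[0,0,0,1],[1,0,0,0],[0,-1,0,0]]`. -/
noncomputable def J2m : Matrix (Fin 8) (Fin 8) ℝ :=
  !![0, 0,-1, 0, 0, 0, 0, 0;
     0, 0, 0, 1, 0, 0, 0, 0;
     1, 0, 0, 0, 0, 0, 0, 0;
     0,-1, 0, 0, 0, 0, 0, 0;
     0, 0, 0, 0, 0, 0,-1, 0;
     0, 0, 0, 0, 0, 0, 0, 1;
     0, 0, 0, 0, 1, 0, 0, 0;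
     0, 0, 0, 0, 0,-1, 0, 0]

/-- `J₃ = J₁J₂` on `ℝ⁸ = n₁ ⊕ n₂`, acting on each factor by
`[[0,0,0,-1],[0,0,-1,0],[0,1,0,0],[1,0,0,0]]`. -/
noncomputable def J3m : Matrix (Fin 8) (Fin 8) ℝ :=
  !![0, 0, 0,-1, 0, 0, 0, 0;
     0, 0,-1, 0, 0, 0, 0, 0;
     0, 1, 0, 0, 0, 0, 0, 0;
     1, 0, 0, 0, 0, 0, 0, 0;
     0, 0, 0, 0, 0, 0, 0,-1;
     0, 0, 0, 0, 0, 0,-1, 0;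
     0, 0, 0, 0, 0, 1, 0, 0;
     0, 0, 0, 0, 1, 0, 0, 0]

/-- `J₁` acting on coefficient vectors in `ℝ⁴`. -/
noncomputable def J1b : Matrix (Fin 4) (Fin 4) ℝ :=
  !![0,-1, 0, 0; 1, 0, 0, 0; 0, 0, 0,-1; 0, 0, 1, 0]

/-- `J₂` acting on coefficient vectors in `ℝ⁴`. -/
noncomputable def J2b : Matrix (Fin 4) (Fin 4) ℝ :=
  !![0, 0,-1, 0; 0, 0, 0, 1; 1, 0, 0, 0; 0,-1, 0, 0]

/-- The vector `a₁Z_1 + a₂Z_2 + a₃Z_3 + a₄Z_4 ∈ n₂ ⊆ ℝ⁸`. -/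
noncomputable def zvec8 (a : Fin 4 → ℝ) : Fin 8 → ℝ :=
  a 0 • stdb 8 4 + a 1 • stdb 8 5 + a 2 • stdb 8 6 + a 3 • stdb 8 7

/-- The element of `W₈ = Λ²n₁* ⊗ n₂` (extended to a 2-step nilpotent bracket on
`ℝ⁸ = n₁ ⊕ n₂` with `n₂` central) with coefficient vectors `A,B,C,D,E,F ∈ ℝ⁴`:
`μ(X_1,X_2) = Σ aₖZₖ`, `μ(X_1,X_3) = Σ bₖZₖ`, `μ(X_1,X_4) = Σ cₖZₖ`,
`μ(X_2,X_3) = Σ dₖZₖ`, `μ(X_2,X_4) = Σ eₖZₖ`, `μ(X_3,X_4) = Σ fₖZₖ`. -/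
noncomputable def muW8 (A B C D E F : Fin 4 → ℝ) : Vm 8 :=
  fun X Y =>
    (X 0 * Y 1 - X 1 * Y 0) • zvec8 A +
    (X 0 * Y 2 - X 2 * Y 0) • zvec8 B +
    (X 0 * Y 3 - X 3 * Y 0) • zvec8 C +
    (X 1 * Y 2 - X 2 * Y 1) • zvec8 D +
    (X 1 * Y 3 - X 3 * Y 1) • zvec8 E +
    (X 2 * Y 3 - X 3 * Y 2) • zvec8 F

/-- The almost-complex structure given by the matrix `Jm` is integrable on `(ℝ⁸, μ)`. -/
def Integr8 (Jm : Matrix (Fin 8) (Fin 8) ℝ) (μ : Vm 8) : Prop :=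
  ∀ X Y : Fin 8 → ℝ,
    μ (Jm.mulVec X) (Jm.mulVec Y) =
      μ X Y + Jm.mulVec (μ (Jm.mulVec X) Y) + Jm.mulVec (μ X (Jm.mulVec Y))

/-- The invariant Ricci operator
`Ricg_μ = (1/4)(Ric_μ - J₁Ric_μJ₁ - J₂Ric_μJ₂ - J₃Ric_μJ₃)` on `ℝ⁸`. -/
noncomputable def Ricg8 (μ : Vm 8) : Matrix (Fin 8) (Fin 8) ℝ :=
  (1/4 : ℝ) • (Ric μ - J1m * Ric μ * J1m - J2m * Ric μ * J2m - J3m * Ric μ * J3m)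

/-- The Ricci operator is symmetric. -/
lemma Ric_comm {m : ℕ} (μ : Vm m) (x y : Fin m) : Ric μ x y = Ric μ y x := by
  simp only [Ric, Matrix.of_apply]
  congr 2 <;> exact Finset.sum_congr rfl fun i _ => Finset.sum_congr rfl fun j _ => mul_comm _ _

lemma zvec8_apply_of_lt (a : Fin 4 → ℝ) {i : Fin 8} (hi : (i : ℕ) < 4) : zvec8 a i = 0 := by
  fin_cases i <;> simp_all [zvec8, stdb]

/-- `μ` takes values in `n₂`. -/
lemma muW8_apply_of_lt (A B C D E F : Fin 4 → ℝ) (X Y : Fin 8 → ℝ) {i : Fin 8}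
    (hi : (i : ℕ) < 4) : muW8 A B C D E F X Y i = 0 := by
  simp [muW8, zvec8_apply_of_lt _ hi]

/-- `n₂` is central. -/
lemma muW8_stdb_of_le (A B C D E F : Fin 4 → ℝ) (Y : Fin 8 → ℝ) {i : Fin 8}
    (hi : 4 ≤ (i : ℕ)) : muW8 A B C D E F (stdb 8 i) Y = 0 := by
  fin_cases i <;> simp_all [muW8, stdb]

/-- `Ric_μ` preserves the splitting `n₁ ⊕ n₂`. -/
lemma Ric_muW8_offDiag (A B C D E F : Fin 4 → ℝ) {x y : Fin 8}
    (hx : (x : ℕ) < 4) (hy : 4 ≤ (y : ℕ)) : Ric (muW8 A B C D E F) x y = 0 := by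
  simp [Ric, muW8_apply_of_lt _ _ _ _ _ _ _ _ hx, muW8_stdb_of_le _ _ _ _ _ _ _ hy]

/-- Conjugating by a skew-symmetric signed permutation matrix. -/
lemma signedPerm_mul_mul_apply {n : Type*} [Fintype n] [DecidableEq n] (J R : Matrix n n ℝ)
    (σ : n → n) (s : n → ℝ) (hrow : ∀ i j, J i j = if j = σ i then s i else 0)
    (hcol : ∀ i j, J i j = if i = σ j then -s j else 0) (i j : n) :
    (J * R * J) i j = -(s i * R (σ i) (σ j) * s j) := by
  have hleft (k : n) : (J * R) i k = s i * R (σ i) k := by simp [Matrix.mul_apply, hrow]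
  rw [Matrix.mul_apply]
  simp [hleft, hcol]

lemma J1m_mul_mul_apply (R : Matrix (Fin 8) (Fin 8) ℝ) (i j : Fin 8) :
    (J1m * R * J1m) i j = -((![-1, 1, -1, 1, -1, 1, -1, 1] : Fin 8 → ℝ) i *
      R ((![1, 0, 3, 2, 5, 4, 7, 6] : Fin 8 → Fin 8) i)
        ((![1, 0, 3, 2, 5, 4, 7, 6] : Fin 8 → Fin 8) j) *
      (![-1, 1, -1, 1, -1, 1, -1, 1] : Fin 8 → ℝ) j) := by
  refine signedPerm_mul_mul_apply J1m R _ _ ?_ ?_ i j <;> intro i j <;>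
    fin_cases i <;> fin_cases j <;> simp [J1m]

lemma J2m_mul_mul_apply (R : Matrix (Fin 8) (Fin 8) ℝ) (i j : Fin 8) :
    (J2m * R * J2m) i j = -((![-1, 1, 1, -1, -1, 1, 1, -1] : Fin 8 → ℝ) i *
      R ((![2, 3, 0, 1, 6, 7, 4, 5] : Fin 8 → Fin 8) i)
        ((![2, 3, 0, 1, 6, 7, 4, 5] : Fin 8 → Fin 8) j) *
      (![-1, 1, 1, -1, -1, 1, 1, -1] : Fin 8 → ℝ) j) := by
  refine signedPerm_mul_mul_apply J2m R _ _ ?_ ?_ i j <;> intro i j <;>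
    fin_cases i <;> fin_cases j <;> simp [J2m]

lemma J3m_mul_mul_apply (R : Matrix (Fin 8) (Fin 8) ℝ) (i j : Fin 8) :
    (J3m * R * J3m) i j = -((![-1, -1, 1, 1, -1, -1, 1, 1] : Fin 8 → ℝ) i *
      R ((![3, 2, 1, 0, 7, 6, 5, 4] : Fin 8 → Fin 8) i)
        ((![3, 2, 1, 0, 7, 6, 5, 4] : Fin 8 → Fin 8) j) *
      (![-1, -1, 1, 1, -1, -1, 1, 1] : Fin 8 → ℝ) j) := by
  refine signedPerm_mul_mul_apply J3m R _ _ ?_ ?_ i j <;> intro i j <;>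
    fin_cases i <;> fin_cases j <;> simp [J3m]

/-- Averaging a symmetric operator preserving `n₁` and `n₂` over the quaternionic structure
gives a multiple of the identity on each factor. -/
lemma quaternionic_average_eq_diagonal (R : Matrix (Fin 8) (Fin 8) ℝ)
    (hsymm : ∀ x y, R x y = R y x)
    (hoff : ∀ x y : Fin 8, (x : ℕ) < 4 → 4 ≤ (y : ℕ) → R x y = 0) :
    (1/4 : ℝ) • (R - J1m * R * J1m - J2m * R * J2m - J3m * R * J3m) =
      Matrix.diagonal (fun i : Fin 8 => if (i : ℕ) < 4
        then (R 0 0 + R 1 1 + R 2 2 + R 3 3) / 4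
        else (R 4 4 + R 5 5 + R 6 6 + R 7 7) / 4) := by
  have hoff' : ∀ x y : Fin 8, 4 ≤ (x : ℕ) → (y : ℕ) < 4 → R x y = 0 := fun x y hx hy =>
    (hsymm x y).trans (hoff y x hy hx)
  ext i j
  simp only [Matrix.smul_apply, Matrix.sub_apply, Matrix.diagonal_apply, J1m_mul_mul_apply,
    J2m_mul_mul_apply, J3m_mul_mul_apply]
  fin_cases i <;> fin_cases j <;>
    simp [hoff, hoff'] <;>
    linarith [hsymm 0 1, hsymm 0 2, hsymm 0 3, hsymm 1 2, hsymm 1 3, hsymm 2 3,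
      hsymm 4 5, hsymm 4 6, hsymm 4 7, hsymm 5 6, hsymm 5 7, hsymm 6 7]

/-- The map `tI` on `n₁` and `2tI` on `n₂` is a derivation of `μ`. -/
lemma isDeriv_muW8_diagonal (A B C D E F : Fin 4 → ℝ) (t : ℝ) :
    IsDeriv (muW8 A B C D E F)
      (Matrix.diagonal (fun i : Fin 8 => if (i : ℕ) < 4 then t else 2 * t)) := by
  intro X Y
  ext i
  by_cases hi : (i : ℕ) < 4
  · simp [Matrix.mulVec_diagonal, muW8_apply_of_lt _ _ _ _ _ _ _ _ hi]
  · simp only [muW8, Matrix.mulVec_diagonal, if_neg hi, Pi.add_apply, Pi.smul_apply, smul_eq_mul]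
    norm_num
    ring

/-- for every `μ ∈ W₈`, `Ricg_μ = pI ⊕ qI` (i.e. `pI` on `n₁` and `qI` on
`n₂`) for some `p,q ∈ ℝ`, the map `(q-p)I ⊕ 2(q-p)I` is a derivation of `μ`, and hence
`Ricg_μ = cI + D` for some `c ∈ ℝ` and derivation `D ∈ Der(μ)`. -/
theorem muW8_Ricg_minimal (A B C D E F : Fin 4 → ℝ) :
    ∃ p q : ℝ,
      Ricg8 (muW8 A B C D E F) =
          Matrix.diagonal (fun i : Fin 8 => if (i : ℕ) < 4 then p else q) ∧
      IsDeriv (muW8 A B C D E F)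
          (Matrix.diagonal (fun i : Fin 8 => if (i : ℕ) < 4 then q - p else 2*(q - p))) ∧
      (∃ (c : ℝ) (Dm : Matrix (Fin 8) (Fin 8) ℝ),
        Ricg8 (muW8 A B C D E F) = c • (1 : Matrix (Fin 8) (Fin 8) ℝ) + Dm ∧
          IsDeriv (muW8 A B C D E F) Dm) := by
  obtain ⟨p, q, hpq⟩ : ∃ p q : ℝ, Ricg8 (muW8 A B C D E F) =
      Matrix.diagonal (fun i : Fin 8 => if (i : ℕ) < 4 then p else q) :=
    ⟨_, _, quaternionic_average_eq_diagonal _ (Ric_comm _)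
      fun _ _ => Ric_muW8_offDiag A B C D E F⟩
  have hD := isDeriv_muW8_diagonal A B C D E F (q - p)
  refine ⟨p, q, hpq, hD, 2 * p - q, _, ?_, hD⟩
  rw [hpq, Matrix.smul_one_eq_diagonal, Matrix.diagonal_add]
  congr 1
  ext i
  split_ifs <;> ring
end

section
/- For 0 ≤ t ≤ 1/√3 let μ_t ∈ W₈ be the bracket with μ_t(X_1,X_2) = √(1−3t²) Z_1 + t Z_2, μ_t(X_1,X_3) = t Z_3, μ_t(X_1,X_4) = t Z_4, μ_t(X_2,X_3) = t Z_4, μ_t(X_2,X_4) = −t Z_3, μ_t(X_3,X_4) = −√(1−3t²) Z_1 + t Z_2 (other brackets of basis vectors zero). Then: (1) J₁, J₂, J₃ are integrable on (ℝ⁸, μ_t) for every t, and for t > 0 the hypercomplex structure is not abelian; (2) the restriction of Ric_{μ_t} to n₂ equals diag(1−3t², t², t², t²); and (3) for 0 ≤ t < t′ ≤ 1/√3 there is no orthogonal linear map φ ∈ O(8) with φ(μ_t(X,Y)) = μ_{t′}(φX, φY) for all X,Y. -/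
open scoped BigOperators Matrix

/-- The bracket `μ_t ∈ W₈`: `μ_t(X_1,X_2) = √(1-3t²)Z_1 + tZ_2`, `μ_t(X_1,X_3) = tZ_3`,
`μ_t(X_1,X_4) = tZ_4`, `μ_t(X_2,X_3) = tZ_4`, `μ_t(X_2,X_4) = -tZ_3`,
`μ_t(X_3,X_4) = -√(1-3t²)Z_1 + tZ_2`. -/
noncomputable def muT (t : ℝ) : Vm 8 :=
  muW8 ![Real.sqrt (1 - 3*t^2), t, 0, 0] ![0, 0, t, 0] ![0, 0, 0, t]
    ![0, 0, 0, t] ![0, 0, -t, 0] ![-Real.sqrt (1 - 3*t^2), t, 0, 0]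

theorem zvec8_eq (a : Fin 4 → ℝ) : zvec8 a = ![0, 0, 0, 0, a 0, a 1, a 2, a 3] := by
  ext k
  fin_cases k <;> simp [zvec8, stdb]

theorem muW8_eq_sum (A B C D E F : Fin 4 → ℝ) (X Y : Fin 8 → ℝ) (k : Fin 8) :
    muW8 A B C D E F X Y k =
      ∑ i, ∑ j, X i * Y j * muW8 A B C D E F (stdb 8 i) (stdb 8 j) k := by
  simp only [muW8, Fin.sum_univ_eight, stdb, Pi.single_apply, Pi.add_apply, Pi.smul_apply]
  simp [Fin.ext_iff]
  ring

theorem J1m_mulVec (X : Fin 8 → ℝ) :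
    J1m.mulVec X = ![-X 1, X 0, -X 3, X 2, -X 5, X 4, -X 7, X 6] := by
  ext k
  fin_cases k <;> simp [J1m, Matrix.mulVec, dotProduct, Fin.sum_univ_eight]

theorem J2m_mulVec (X : Fin 8 → ℝ) :
    J2m.mulVec X = ![-X 2, X 3, X 0, -X 1, -X 6, X 7, X 4, -X 5] := by
  ext k
  fin_cases k <;> simp [J2m, Matrix.mulVec, dotProduct, Fin.sum_univ_eight]

theorem J3m_mulVec (X : Fin 8 → ℝ) :
    J3m.mulVec X = ![-X 3, -X 2, X 1, X 0, -X 7, -X 6, X 5, X 4] := by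
  ext k
  fin_cases k <;> simp [J3m, Matrix.mulVec, dotProduct, Fin.sum_univ_eight]

theorem muT_eq (t : ℝ) (X Y : Fin 8 → ℝ) :
    muT t X Y = ![0, 0, 0, 0,
      √(1 - 3 * t ^ 2) * ((X 0 * Y 1 - X 1 * Y 0) - (X 2 * Y 3 - X 3 * Y 2)),
      t * ((X 0 * Y 1 - X 1 * Y 0) + (X 2 * Y 3 - X 3 * Y 2)),
      t * ((X 0 * Y 2 - X 2 * Y 0) - (X 1 * Y 3 - X 3 * Y 1)),
      t * ((X 0 * Y 3 - X 3 * Y 0) + (X 1 * Y 2 - X 2 * Y 1))] := by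
  ext k
  simp only [muT, muW8, zvec8_eq]
  fin_cases k <;> simp <;> ring

theorem integr8_J1m_muT (t : ℝ) : Integr8 J1m (muT t) := by
  intro X Y
  simp only [J1m_mulVec, muT_eq]
  ext k
  fin_cases k <;> simp <;> ring

theorem integr8_J2m_muT (t : ℝ) : Integr8 J2m (muT t) := by
  intro X Y
  simp only [J2m_mulVec, muT_eq]
  ext k
  fin_cases k <;> simp <;> ring

theorem integr8_J3m_muT (t : ℝ) : Integr8 J3m (muT t) := by
  intro X Y
  simp only [J3m_mulVec, muT_eq]
  ext k
  fin_cases k <;> simp <;> ring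

/-- The Gram matrix `∑ᵢⱼ ⟨μ(eᵢ, eⱼ), e_x⟩⟨μ(eᵢ, eⱼ), e_y⟩` of the structure constants. -/
noncomputable def bracketGram {m : ℕ} (μ : Vm m) : Matrix (Fin m) (Fin m) ℝ :=
  Matrix.of fun x y => ∑ i, ∑ j, μ (stdb m i) (stdb m j) x * μ (stdb m i) (stdb m j) y

theorem bracketGram_eq_conj {m : ℕ} {μ μ' : Vm m} {φ : Matrix (Fin m) (Fin m) ℝ}
    (hμ : ∀ X Y k, μ X Y k = ∑ i, ∑ j, X i * Y j * μ (stdb m i) (stdb m j) k)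
    (hφ : φᵀ * φ = 1) (h : ∀ X Y, φ.mulVec (μ X Y) = μ' (φ.mulVec X) (φ.mulVec Y)) :
    bracketGram μ' = φ * bracketGram μ * φᵀ := by
  have hφ' : φ * φᵀ = 1 := mul_eq_one_comm.mp hφ
  let M (i : Fin m) : Matrix (Fin m) (Fin m) ℝ := Matrix.of fun j k => μ (stdb m i) (stdb m j) k
  let M' (i : Fin m) : Matrix (Fin m) (Fin m) ℝ := Matrix.of fun j k => μ' (stdb m i) (stdb m j) k
  have hM : bracketGram μ = ∑ i, (M i)ᵀ * M i := by
    ext x y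
    simp [bracketGram, M, Matrix.sum_apply, Matrix.mul_apply]
  have hM' : bracketGram μ' = ∑ i, (M' i)ᵀ * M' i := by
    ext x y
    simp [bracketGram, M', Matrix.sum_apply, Matrix.mul_apply]
  have hconj (a : Fin m) : M' a = ∑ i, φ a i • (φ * M i * φᵀ) := by
    ext b l
    have := congrFun (h (φᵀ.mulVec (stdb m a)) (φᵀ.mulVec (stdb m b))) l
    simp only [Matrix.mulVec_mulVec, hφ', Matrix.one_mulVec] at this
    simp only [M', Matrix.of_apply, ← this]
    have hcol (c i : Fin m) : φᵀ.mulVec (stdb m c) i = φ c i := by simp [stdb]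
    rw [Matrix.mulVec, dotProduct]
    simp only [hμ (φᵀ.mulVec _), hcol, M, Matrix.sum_apply, Matrix.smul_apply, Matrix.mul_apply,
      Matrix.of_apply, Matrix.transpose_apply, smul_eq_mul, Finset.mul_sum, Finset.sum_mul]
    rw [Finset.sum_comm]
    refine Finset.sum_congr rfl fun i _ => Finset.sum_congr rfl fun k _ =>
      Finset.sum_congr rfl fun j _ => ?_
    ring
  have hφφ (i j : Fin m) : ∑ a, φ a i * φ a j = if i = j then 1 else 0 := by
    simpa [Matrix.mul_apply, Matrix.one_apply] using congrFun₂ hφ i j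
  have key (i j : Fin m) : (φ * M i * φᵀ)ᵀ * (φ * M j * φᵀ) = φ * ((M i)ᵀ * M j) * φᵀ := by
    calc _ = φ * (M i)ᵀ * (φᵀ * φ) * M j * φᵀ := by
          simp only [Matrix.transpose_mul, Matrix.transpose_transpose, Matrix.mul_assoc]
      _ = _ := by rw [hφ, Matrix.mul_one]; simp only [Matrix.mul_assoc]
  calc bracketGram μ' = ∑ a, ∑ i, ∑ j, (φ a i * φ a j) • (φ * ((M i)ᵀ * M j) * φᵀ) := by
        rw [hM']
        refine Finset.sum_congr rfl fun a _ => ?_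
        rw [hconj, Matrix.transpose_sum, Finset.sum_mul_sum]
        simp only [Matrix.transpose_smul, Matrix.smul_mul, Matrix.mul_smul, smul_smul, key]
        refine Finset.sum_congr rfl fun i _ => Finset.sum_congr rfl fun j _ => ?_
        rw [mul_comm]
    _ = ∑ i, ∑ j, (∑ a, φ a i * φ a j) • (φ * ((M i)ᵀ * M j) * φᵀ) := by
        rw [Finset.sum_comm]
        refine Finset.sum_congr rfl fun i _ => ?_
        rw [Finset.sum_comm]
        simp only [Finset.sum_smul]
    _ = φ * bracketGram μ * φᵀ := by
        simp [hφφ, hM, Finset.mul_sum, Finset.sum_mul]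

theorem trace_conj_pow {m : ℕ} {φ N : Matrix (Fin m) (Fin m) ℝ} (hφ : φᵀ * φ = 1) (n : ℕ) :
    ((φ * N * φᵀ) ^ n).trace = (N ^ n).trace := by
  have hφ' : φ * φᵀ = 1 := mul_eq_one_comm.mp hφ
  have hpow : (φ * N * φᵀ) ^ n = φ * N ^ n * φᵀ := Units.conj_pow ⟨φ, φᵀ, hφ', hφ⟩ N n
  rw [hpow, Matrix.trace_mul_cycle, hφ, Matrix.one_mul]

theorem bracketGram_muW8_apply (A B C D E F : Fin 4 → ℝ) (x y : Fin 8) :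
    bracketGram (muW8 A B C D E F) x y =
      2 * (zvec8 A x * zvec8 A y + zvec8 B x * zvec8 B y + zvec8 C x * zvec8 C y +
        zvec8 D x * zvec8 D y + zvec8 E x * zvec8 E y + zvec8 F x * zvec8 F y) := by
  simp only [bracketGram, Matrix.of_apply, Fin.sum_univ_eight, muW8, stdb, Pi.single_apply]
  simp [Fin.ext_iff]
  ring

theorem bracketGram_muT {t : ℝ} (ht : 0 ≤ 1 - 3 * t ^ 2) :
    bracketGram (muT t) = Matrix.diagonal
      ![0, 0, 0, 0, 4 * (1 - 3 * t ^ 2), 4 * t ^ 2, 4 * t ^ 2, 4 * t ^ 2] := by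
  have hs := Real.mul_self_sqrt ht
  ext x y
  simp only [muT, bracketGram_muW8_apply, zvec8_eq, Matrix.diagonal_apply]
  fin_cases x <;> fin_cases y <;> simp <;> first | ring1 | linear_combination 4 * hs

theorem one_sub_three_mul_sq_nonneg {t : ℝ} (h0 : 0 ≤ t) (h3 : t ≤ 1 / √3) :
    0 ≤ 1 - 3 * t ^ 2 := by
  have h := pow_le_pow_left₀ h0 h3 2
  rw [div_pow, Real.sq_sqrt (by norm_num)] at h
  linarith

theorem muT_stdb_left (t : ℝ) {i : Fin 8} (hi : 4 ≤ (i : ℕ)) (Y : Fin 8 → ℝ) :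
    muT t (stdb 8 i) Y = 0 := by
  have h (k : Fin 8) (hk : (k : ℕ) < 4) : stdb 8 i k = 0 :=
    Pi.single_eq_of_ne (by omega) 1
  simp [muT, muW8, h]

theorem Ric_muT_apply {t : ℝ} (ht : 0 ≤ 1 - 3 * t ^ 2) {i j : Fin 8} (hi : 4 ≤ (i : ℕ)) :
    Ric (muT t) i j = if i = j then (if (i : ℕ) = 4 then 1 - 3*t^2 else t^2) else 0 := by
  have hR : Ric (muT t) i j = 1 / 4 * bracketGram (muT t) i j := by
    simp [Ric, bracketGram, muT_stdb_left t hi]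
  rw [hR, bracketGram_muT ht, Matrix.diagonal_apply]
  split_ifs with hij h4
  · obtain rfl : i = 4 := Fin.ext h4
    simp
  · fin_cases i <;> simp_all
  · simp

theorem sq_eq_sq_of_muT_equiv {t t' : ℝ} (ht : 0 ≤ 1 - 3 * t ^ 2) (ht' : 0 ≤ 1 - 3 * t' ^ 2)
    {φ : Matrix (Fin 8) (Fin 8) ℝ} (hφ : φᵀ * φ = 1)
    (h : ∀ X Y, φ.mulVec (muT t X Y) = muT t' (φ.mulVec X) (φ.mulVec Y)) :
    t ^ 2 = t' ^ 2 := by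
  have hN := bracketGram_eq_conj (μ := muT t) (muW8_eq_sum _ _ _ _ _ _) hφ h
  have htr (n : ℕ) : (bracketGram (muT t') ^ n).trace = (bracketGram (muT t) ^ n).trace := by
    rw [hN, trace_conj_pow hφ]
  have h2 := htr 2
  have h3 := htr 3
  rw [bracketGram_muT ht, bracketGram_muT ht', Matrix.diagonal_pow, Matrix.diagonal_pow,
    Matrix.trace_diagonal, Matrix.trace_diagonal] at h2 h3
  simp [Fin.sum_univ_eight] at h2 h3
  generalize t ^ 2 = s at *
  generalize t' ^ 2 = s' at *
  by_contra hne
  have hsub : s - s' ≠ 0 := sub_ne_zero.mpr hne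
  have hsum : s + s' = 1 / 2 := by
    apply mul_left_cancel₀ hsub
    linear_combination (-1 / 192) * h2
  have hcubic : -9 + 27 * (s + s') - 24 * (s ^ 2 + s * s' + s' ^ 2) = 0 := by
    apply mul_left_cancel₀ hsub
    linear_combination (-1 / 64) * h3
  obtain rfl : s' = 1 / 2 - s := by linarith
  have hs : (s - 1 / 4) ^ 2 = 0 := by linear_combination (-1 / 24) * hcubic
  have := pow_eq_zero_iff two_ne_zero |>.mp hs
  exact hne (by linarith)

theorem not_abelian_muT {t : ℝ} (ht : 0 < t) :
    ¬ ∀ X Y : Fin 8 → ℝ, muT t (J1m.mulVec X) (J1m.mulVec Y) = muT t X Y := by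
  intro h
  have := congrFun (h (stdb 8 0) (stdb 8 2)) 6
  simp only [muT_eq, J1m_mulVec] at this
  simp [stdb] at this
  linarith

/-- (1) for all `0 ≤ t ≤ 1/√3` the structure `{J₁,J₂,J₃}` is hypercomplex
(integrable) on `(ℝ⁸, μ_t)` and non-abelian for `t > 0`; (2) `Ric_{μ_t}|_{n₂} =
diag(1-3t², t², t², t²)`; (3) for `0 ≤ t < t' ≤ 1/√3` there is no orthogonal `φ ∈ O(8)`
intertwining `μ_t` and `μ_{t'}`. -/
theorem muT_curve (t t' : ℝ) (ht0 : 0 ≤ t) (ht3 : t ≤ 1 / Real.sqrt 3)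
    (ht0' : 0 ≤ t') (ht3' : t' ≤ 1 / Real.sqrt 3) :
    (Integr8 J1m (muT t) ∧ Integr8 J2m (muT t) ∧ Integr8 J3m (muT t)) ∧
    (0 < t → ¬ ∀ X Y : Fin 8 → ℝ,
        muT t (J1m.mulVec X) (J1m.mulVec Y) = muT t X Y ∧
        muT t (J2m.mulVec X) (J2m.mulVec Y) = muT t X Y ∧
        muT t (J3m.mulVec X) (J3m.mulVec Y) = muT t X Y) ∧
    (∀ i j : Fin 8, 4 ≤ (i : ℕ) → 4 ≤ (j : ℕ) →
        Ric (muT t) i j =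
          if i = j then (if (i : ℕ) = 4 then 1 - 3*t^2 else t^2) else 0) ∧
    (t < t' →
      ¬ ∃ φ : Matrix (Fin 8) (Fin 8) ℝ, φᵀ * φ = 1 ∧
          ∀ X Y : Fin 8 → ℝ, φ.mulVec (muT t X Y) = muT t' (φ.mulVec X) (φ.mulVec Y)) := by
  have hs := one_sub_three_mul_sq_nonneg ht0 ht3
  have hs' := one_sub_three_mul_sq_nonneg ht0' ht3'
  refine ⟨⟨integr8_J1m_muT t, integr8_J2m_muT t, integr8_J3m_muT t⟩,
    fun ht hab => not_abelian_muT ht fun X Y => (hab X Y).1,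
    fun _ _ hi _ => Ric_muT_apply hs hi, ?_⟩
  rintro hlt ⟨φ, hφ, h⟩
  have := sq_eq_sq_of_muT_equiv hs hs' hφ h
  exact hlt.ne ((pow_left_inj₀ ht0 ht0' two_ne_zero).mp this)
end
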